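/- Every bidirectional temporal spanner of G_SC contains, in its footprint, all 2(n+m+3)−3 edges incident to v_1 or v_2. -/

import Mathlib

namespace TemporalPaper

/-- A temporal graph on vertex set `V`: an undirected labeling assigning to each
(unordered) pair of vertices a finite set of rational time labels; a pair is an
edge of the graph iff its label set is nonempty. -/
structure TemporalGraph (V : Type*) where
  label : V → V → Finset ℚ
  symm : ∀ u v, label u v = label v u
  loopless : ∀ v, label v v = ∅

namespace TemporalGraph

variable {V : Type*}

/-- The footprint (static underlying graph) of a temporal graph. -/
def footprint (G : TemporalGraph V) : SimpleGraph V where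
  Adj u v := (G.label u v).Nonempty
  symm := ⟨fun u v h => by change (G.label u v).Nonempty at h; change (G.label v u).Nonempty; rwa [G.symm]⟩
  loopless := ⟨fun v h => by change (G.label v v).Nonempty at h; rw [G.loopless] at h; exact Finset.not_nonempty_empty h⟩

/-- The snapshot of a temporal graph at time `t`. -/
def snapshot (G : TemporalGraph V) (t : ℚ) : SimpleGraph V where
  Adj u v := t ∈ G.label u v
  symm := ⟨fun u v h => by change t ∈ G.label u v at h; change t ∈ G.label v u; rwa [G.symm]⟩
  loopless := ⟨fun v h => by change t ∈ G.label v v at h; rw [G.loopless] at h; exact absurd h (Finset.notMem_empty t)⟩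

/-- `G.IsTJ r p ts` : the list of vertices `p` together with the list of times `ts`
(one per consecutive pair of vertices of `p`) forms a temporal walk, i.e. each time
belongs to the labels of the corresponding edge, and consecutive times satisfy `r`
(`r = (· ≤ ·)` for non-strict temporal walks, `r = (· < ·)` for strict ones). -/
inductive IsTJ (G : TemporalGraph V) (r : ℚ → ℚ → Prop) : List V → List ℚ → Prop
  | single (v : V) : IsTJ G r [v] []
  | cons {u v : V} {p : List V} {t : ℚ} {ts : List ℚ} :
      t ∈ G.label u v → IsTJ G r (v :: p) ts →
      (∀ t' ∈ ts.head?, r t t') → IsTJ G r (u :: v :: p) (t :: ts)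

/-- A temporal path from `u` to `v` with underlying (vertex-)path `p` and times `ts`. -/
def TPath (G : TemporalGraph V) (r : ℚ → ℚ → Prop) (u v : V)
    (p : List V) (ts : List ℚ) : Prop :=
  G.IsTJ r p ts ∧ p.Nodup ∧ p.head? = some u ∧ p.getLast? = some v

/-- Temporal reachability. -/
def Reach (G : TemporalGraph V) (r : ℚ → ℚ → Prop) (u v : V) : Prop :=
  ∃ p ts, G.TPath r u v p ts

def TemporallyConnectedRel (G : TemporalGraph V) (r : ℚ → ℚ → Prop) : Prop :=
  ∀ u v : V, u ≠ v → G.Reach r u v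

/-- Temporal connectivity (non-strict setting). -/
def TemporallyConnected (G : TemporalGraph V) : Prop :=
  G.TemporallyConnectedRel (· ≤ ·)

/-- A bidirectional temporal path (bi-path) between `u` and `v` on the underlying
path `p` (from `u` to `v`): a temporal path in each direction along `p`. -/
def BiPath (G : TemporalGraph V) (r : ℚ → ℚ → Prop) (u v : V)
    (p : List V) (ts₁ ts₂ : List ℚ) : Prop :=
  G.TPath r u v p ts₁ ∧ G.TPath r v u p.reverse ts₂

def BiConnectedRel (G : TemporalGraph V) (r : ℚ → ℚ → Prop) : Prop :=
  ∀ u v : V, u ≠ v → ∃ p ts₁ ts₂, G.BiPath r u v p ts₁ ts₂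

/-- Bidirectional temporal connectivity (non-strict setting). -/
def BiConnected (G : TemporalGraph V) : Prop := G.BiConnectedRel (· ≤ ·)

/-- `H` is a temporal subgraph of `G` (on the same vertex set). -/
def IsSubgraph (H G : TemporalGraph V) : Prop := ∀ u v, H.label u v ⊆ G.label u v

/-- A temporal spanner of `G`: a temporally connected temporal subgraph on all of `V`. -/
def IsSpanner (H G : TemporalGraph V) : Prop := H.IsSubgraph G ∧ H.TemporallyConnected

/-- A temporal spanning tree of `G`: a temporal spanner whose footprint is a tree. -/
def IsSpanningTree (H G : TemporalGraph V) : Prop := H.IsSpanner G ∧ H.footprint.IsTree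

/-- A bidirectional temporal spanner (bi-spanner) of `G`. -/
def IsBiSpanner (H G : TemporalGraph V) : Prop := H.IsSpanner G ∧ H.BiConnected

/-- A temporal graph is simple if every edge has exactly one time label,
i.e. every label set has at most one element (edges have nonempty label sets). -/
def Simple (G : TemporalGraph V) : Prop := ∀ u v, (G.label u v).card ≤ 1

/-- A temporal graph is proper if any two (distinct) edges sharing a vertex have
disjoint label sets. -/
def Proper (G : TemporalGraph V) : Prop :=
  ∀ u v w : V, v ≠ w → Disjoint (G.label u v) (G.label u w)

def Happy (G : TemporalGraph V) : Prop := G.Simple ∧ G.Proper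

/-- `u` can reach `v` by a (non-strict) temporal path arriving at time at most `t`. -/
def ArrivesBy (G : TemporalGraph V) (u v : V) (t : ℚ) : Prop :=
  ∃ p ts, G.TPath (· ≤ ·) u v p ts ∧ ∀ t' ∈ ts.getLast?, t' ≤ t

/-- `u` can reach `v` by a (non-strict) temporal path departing at time at least `t`. -/
def DepartsAfter (G : TemporalGraph V) (u v : V) (t : ℚ) : Prop :=
  ∃ p ts, G.TPath (· ≤ ·) u v p ts ∧ ∀ t' ∈ ts.head?, t ≤ t'

/-- A pivot: some time `t` such that every other vertex reaches `x` by time `t`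
and `x` reaches every other vertex departing not earlier than `t`. -/
def IsPivot (G : TemporalGraph V) (x : V) : Prop :=
  ∃ t : ℚ, ∀ u : V, u ≠ x → G.ArrivesBy u x t ∧ G.DepartsAfter x u t

/-- Deleting the (undirected) edge `ab` from a temporal graph. -/
def deleteEdge [DecidableEq V] (G : TemporalGraph V) (a b : V) : TemporalGraph V where
  label u v := if (u = a ∧ v = b) ∨ (u = b ∧ v = a) then ∅ else G.label u v
  symm := by
    intro u v
    have h : ((u = a ∧ v = b) ∨ (u = b ∧ v = a)) ↔ ((v = a ∧ u = b) ∨ (v = b ∧ u = a)) := by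
      tauto
    rw [G.symm, if_congr h rfl rfl]
  loopless := by
    intro v
    split_ifs with h
    · rfl
    · exact G.loopless v

end TemporalGraph

end TemporalPaper

namespace TemporalPaper

open TemporalGraph

/-- Vertices of the temporal graph `G_SC` built from a Set Cover instance with
universe `U = {u_1, …, u_n}` and subsets `S_1, …, S_m`: one vertex per element of `U`,
one vertex per subset, and three auxiliary vertices `v`, `v₁`, `v₂`. -/
inductive Vsc (n m : ℕ) : Type
  | elem : Fin n → Vsc n m
  | set : Fin m → Vsc n m
  | v : Vsc n m
  | v1 : Vsc n m
  | v2 : Vsc n m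
deriving DecidableEq

/-- One orientation of the labeling of `G_SC` (indices taken `1`-based as in the
paper): `v s_i` and, for `u_j ∈ S_i`, `s_i u_j` carry label `i`; `v₁ s_i` and
`v₁ u_j` carry label `m+1`; `v₂ v` and `v₂ s_i` carry label `m+2`; finally the edges
`v₁ v`, `v₁ v₂` and `v₂ u_j` carry pairwise distinct labels (`m+3`, `m+4` and
`m+5+j`) distinct from all other labels of the graph. -/
def coreSC (n m : ℕ) (S : Fin m → Finset (Fin n)) : Vsc n m → Vsc n m → Finset ℚ
  | .v, .set i => {(i : ℚ) + 1}
  | .set i, .elem j => if j ∈ S i then {(i : ℚ) + 1} else ∅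
  | .v1, .set _ => {(m : ℚ) + 1}
  | .v1, .elem _ => {(m : ℚ) + 1}
  | .v2, .v => {(m : ℚ) + 2}
  | .v2, .set _ => {(m : ℚ) + 2}
  | .v1, .v => {(m : ℚ) + 3}
  | .v1, .v2 => {(m : ℚ) + 4}
  | .v2, .elem j => {(m : ℚ) + 5 + (j : ℚ)}
  | _, _ => ∅

/-- The simple temporal graph `G_SC` of the reduction from Set Cover to `k`-BS. -/
def Gsc (n m : ℕ) (S : Fin m → Finset (Fin n)) : TemporalGraph (Vsc n m) where
  label a b := coreSC n m S a b ∪ coreSC n m S b a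
  symm := fun a b => Finset.union_comm _ _
  loopless := fun a => by cases a <;> simp [coreSC]

end TemporalPaper

namespace TemporalPaper

namespace TemporalGraph

variable {V : Type*}

theorem IsTJ.exists_of_append {G : TemporalGraph V} {r : ℚ → ℚ → Prop} {a b c : V} :
    ∀ {l : List V} {ts : List ℚ}, G.IsTJ r (l ++ [a, b, c]) ts →
      ∃ s ∈ G.label a b, ∃ t ∈ G.label b c, r s t
  | [], _, .cons hs (.cons ht _ _) hr => ⟨_, hs, _, ht, hr _ rfl⟩
  | [_], _, .cons _ h _ => IsTJ.exists_of_append (l := []) h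
  | _ :: x :: l, _, .cons _ h _ => IsTJ.exists_of_append (l := x :: l) h

/-- A label class containing an edge at `c` is a star centered at `c`. -/
def IsStarCenter (G : TemporalGraph V) (c : V) : Prop :=
  ∀ ⦃a b : V⦄ ⦃t : ℚ⦄, t ∈ G.label c a → t ∈ G.label a b → b = c

/-- In a simple temporal graph all labels along a bi-path coincide, so that a bi-path starting
at a star center is a single edge. -/
theorem BiConnected.footprint_adj_of_isStarCenter {G H : TemporalGraph V} (hH : H.BiConnected)
    (hsub : H.IsSubgraph G) (hG : G.Simple) {c x : V} (hc : G.IsStarCenter c) (hx : x ≠ c) :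
    H.footprint.Adj c x := by
  obtain ⟨p, ts, ts', ⟨hp, hnodup, hhead, hlast⟩, hrev, -⟩ := hH c x hx.symm
  cases hp with
  | single w =>
    simp only [List.head?_cons, List.getLast?_singleton, Option.some.injEq] at hhead hlast
    exact absurd (hlast.symm.trans hhead) hx
  | @cons c' a p s ts hs hp hle =>
    obtain rfl : c' = c := by simpa using hhead
    cases hp with
    | single =>
      obtain rfl : a = x := by simpa using hlast
      exact ⟨s, hs⟩
    | @cons _ b p t ts ht hp hle' =>
      have hst : s ≤ t := hle t rfl
      rw [show (c' :: a :: b :: p).reverse = p.reverse ++ [b, a, c'] by simp] at hrev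
      obtain ⟨t', ht', s', hs', hle''⟩ := hrev.exists_of_append
      rw [H.symm] at ht' hs'
      have hss : s = s' := Finset.card_le_one.1 (hG _ _) _ (hsub _ _ hs) _ (hsub _ _ hs')
      have htt : t = t' := Finset.card_le_one.1 (hG _ _) _ (hsub _ _ ht) _ (hsub _ _ ht')
      have heq : s = t := le_antisymm hst (by rwa [hss, htt])
      have hbc : b = c' := hc (hsub _ _ hs) (hsub _ _ (heq ▸ ht))
      simp [hbc] at hnodup

end TemporalGraph

theorem ncard_edgeSet_incident_of_dominating {V : Type*} [Finite V] (G : SimpleGraph V) {a b : V}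
    (hab : a ≠ b) (ha : ∀ x, x ≠ a → G.Adj a x) (hb : ∀ x, x ≠ b → G.Adj b x) :
    {e ∈ G.edgeSet | a ∈ e ∨ b ∈ e}.ncard = 2 * Nat.card V - 3 := by
  have himage : ∀ c, (∀ x, x ≠ c → G.Adj c x) →
      {e ∈ G.edgeSet | c ∈ e} = (fun x => s(c, x)) '' {c}ᶜ := by
    intro c hc
    ext e
    constructor
    · rintro ⟨he, y, rfl⟩
      exact ⟨y, (G.mem_edgeSet.1 he).ne', rfl⟩
    · rintro ⟨y, hy, rfl⟩
      exact ⟨hc y hy, Sym2.mem_mk_left c y⟩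
  have hcard : ∀ c, (∀ x, x ≠ c → G.Adj c x) →
      {e ∈ G.edgeSet | c ∈ e}.ncard = Nat.card V - 1 := by
    intro c hc
    rw [himage c hc, Set.ncard_image_of_injective _ fun x y h => Sym2.congr_right.1 h,
      Set.ncard_compl, Set.ncard_singleton]
  have hinter : {e ∈ G.edgeSet | a ∈ e} ∩ {e ∈ G.edgeSet | b ∈ e} = {s(a, b)} := by
    ext e
    constructor
    · rintro ⟨⟨-, hae⟩, -, hbe⟩
      exact (Sym2.mem_and_mem_iff hab).1 ⟨hae, hbe⟩
    · rintro rfl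
      exact ⟨⟨ha b hab.symm, Sym2.mem_mk_left a b⟩, ha b hab.symm, Sym2.mem_mk_right a b⟩
  have hunion : {e ∈ G.edgeSet | a ∈ e ∨ b ∈ e}
      = {e ∈ G.edgeSet | a ∈ e} ∪ {e ∈ G.edgeSet | b ∈ e} := by
    ext e
    simp only [Set.mem_ofPred_eq, Set.mem_union]
    tauto
  have h := Set.ncard_union_add_ncard_inter {e ∈ G.edgeSet | a ∈ e} {e ∈ G.edgeSet | b ∈ e}
    (Set.toFinite _) (Set.toFinite _)
  rw [hinter, Set.ncard_singleton, hcard a ha, hcard b hb, ← hunion] at h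
  omega

/-- The vertices of `G_SC` as a sum type. -/
def vscEquiv (n m : ℕ) : Vsc n m ≃ (Fin n ⊕ Fin m) ⊕ Fin 3 where
  toFun
    | .elem j => .inl (.inl j)
    | .set i => .inl (.inr i)
    | .v => .inr 0
    | .v1 => .inr 1
    | .v2 => .inr 2
  invFun
    | .inl (.inl j) => .elem j
    | .inl (.inr i) => .set i
    | .inr 0 => .v
    | .inr 1 => .v1
    | .inr 2 => .v2
  left_inv x := by cases x <;> rfl
  right_inv x := by
    rcases x with (j | i) | k
    · rfl
    · rfl
    · fin_cases k <;> rfl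

instance (n m : ℕ) : Finite (Vsc n m) := .of_equiv _ (vscEquiv n m).symm

theorem card_vsc (n m : ℕ) : Nat.card (Vsc n m) = n + m + 3 := by
  simp [Nat.card_congr (vscEquiv n m)]

section Gsc

variable {n m : ℕ} {S : Fin m → Finset (Fin n)}

theorem Gsc_simple : (Gsc n m S).Simple := by
  intro a b
  cases a <;> cases b <;> simp [Gsc, coreSC] <;> split_ifs <;> simp

theorem Gsc_footprint_adj_v1 (x : Vsc n m) (hx : x ≠ .v1) :
    (Gsc n m S).footprint.Adj .v1 x := by
  cases x <;> simp_all [TemporalGraph.footprint, Gsc, coreSC]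

theorem Gsc_footprint_adj_v2 (x : Vsc n m) (hx : x ≠ .v2) :
    (Gsc n m S).footprint.Adj .v2 x := by
  cases x <;> simp_all [TemporalGraph.footprint, Gsc, coreSC]

theorem Gsc_isStarCenter_v1 : (Gsc n m S).IsStarCenter .v1 := by
  have hlt (i : Fin m) : (i : ℚ) < m := by exact_mod_cast i.2
  intro a b t ha hb
  cases a <;> cases b <;> simp [Gsc, coreSC] at ha hb ⊢ <;> grind

theorem Gsc_isStarCenter_v2 : (Gsc n m S).IsStarCenter .v2 := by
  have hlt (i : Fin m) : (i : ℚ) < m := by exact_mod_cast i.2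
  have hnonneg (j : Fin n) : (0 : ℚ) ≤ j := by positivity
  intro a b t ha hb
  cases a <;> cases b <;> simp [Gsc, coreSC] at ha hb ⊢ <;> grind

end Gsc

/-- every bidirectional temporal spanner of `G_SC` contains, in its
footprint, all edges of `G_SC` incident to `v₁` or `v₂` (and there are
`2(n+m+3) - 3` such edges, `v₁` and `v₂` being adjacent to all other vertices). -/
theorem stmt17 (n m : ℕ) (S : Fin m → Finset (Fin n))
    (hcover : ∀ j : Fin n, ∃ i : Fin m, j ∈ S i)
    (H : TemporalGraph (Vsc n m)) (hbs : H.IsBiSpanner (Gsc n m S)) :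
    (∀ x : Vsc n m, x ≠ Vsc.v1 → H.footprint.Adj Vsc.v1 x) ∧
    (∀ x : Vsc n m, x ≠ Vsc.v2 → H.footprint.Adj Vsc.v2 x) ∧
    {e ∈ (Gsc n m S).footprint.edgeSet | Vsc.v1 ∈ e ∨ Vsc.v2 ∈ e}.ncard
      = 2 * (n + m + 3) - 3 := by
  obtain ⟨⟨hsub, -⟩, hbi⟩ := hbs
  refine ⟨fun x hx => hbi.footprint_adj_of_isStarCenter hsub Gsc_simple Gsc_isStarCenter_v1 hx,
    fun x hx => hbi.footprint_adj_of_isStarCenter hsub Gsc_simple Gsc_isStarCenter_v2 hx, ?_⟩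
  rw [ncard_edgeSet_incident_of_dominating _ (by simp) Gsc_footprint_adj_v1 Gsc_footprint_adj_v2,
    card_vsc]

end TemporalPaper
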